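/- Suppose the pair (A, H) is observable, S is nonempty, and let L* be the unique minimizer of J over S. Then for every α > 0 with S_α nonempty there exists a constant c₃ > 0 (depending only on α and the problem data, not on L) such that for every L ∈ S_α: c₃·‖L − L*‖_F² ≤ J(L) − J(L*). -/

import Mathlib

open Matrix Filter Topology

/-- Spectral radius of a real square matrix: the maximum modulus of its complex
eigenvalues. -/
noncomputable def specRad {n : ℕ} (M : Matrix (Fin n) (Fin n) ℝ) : ENNReal :=
  spectralRadius ℂ (M.map (Complex.ofReal))

/-- Frobenius norm of a real matrix. -/
noncomputable def frobNorm {k l : ℕ} (M : Matrix (Fin k) (Fin l) ℝ) : ℝ :=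
  Real.sqrt (Matrix.trace (Mᵀ * M))

section Frobenius

open scoped Matrix.Norms.Frobenius

theorem Matrix.frobenius_norm_sq_eq_trace {k l : ℕ} (M : Matrix (Fin k) (Fin l) ℝ) :
    ‖M‖ ^ 2 = trace (Mᵀ * M) := by
  rw [frobenius_norm_def, ← Real.sqrt_eq_rpow, Real.sq_sqrt (by positivity), Finset.sum_comm]
  simp [trace, mul_apply, sq]

theorem frobNorm_eq_norm {k l : ℕ} (M : Matrix (Fin k) (Fin l) ℝ) : frobNorm M = ‖M‖ := by
  rw [frobNorm, ← frobenius_norm_sq_eq_trace, Real.sqrt_sq (norm_nonneg M)]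

theorem Matrix.norm_entry_le_frobenius_norm {k l : ℕ} (M : Matrix (Fin k) (Fin l) ℝ)
    (i : Fin k) (j : Fin l) : ‖M i j‖ ≤ ‖M‖ := by
  refine abs_le_of_sq_le_sq ?_ (norm_nonneg M)
  rw [frobenius_norm_sq_eq_trace, trace]
  simp only [diag, mul_apply, transpose_apply]
  calc M i j ^ 2 ≤ ∑ i', M i' j * M i' j := by
        rw [sq]
        exact Finset.single_le_sum (f := fun i' => M i' j * M i' j)
          (fun _ _ => mul_self_nonneg _) (Finset.mem_univ i)
    _ ≤ _ := Finset.single_le_sum (f := fun j' => ∑ i', M i' j' * M i' j')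
          (fun _ _ => Finset.sum_nonneg fun _ _ => mul_self_nonneg _) (Finset.mem_univ j)

theorem exists_norm_pow_le_of_specRad_lt_one {n : ℕ} {P : Matrix (Fin n) (Fin n) ℝ}
    (hP : specRad P < 1) :
    ∃ r : ℝ, 0 ≤ r ∧ r < 1 ∧ ∀ᶠ t : ℕ in atTop, ‖P ^ t‖ ≤ r ^ t := by
  obtain ⟨r, hr, hr1⟩ := ENNReal.lt_iff_exists_nnreal_btwn.1 hP
  have : CompleteSpace (Matrix (Fin n) (Fin n) ℂ) := FiniteDimensional.complete ℂ _
  have h := spectrum.pow_norm_pow_one_div_tendsto_nhds_spectralRadius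
    (P.map Complex.ofReal : Matrix (Fin n) (Fin n) ℂ)
  refine ⟨r, r.2, by exact_mod_cast hr1, ?_⟩
  filter_upwards [h.eventually_lt_const hr, eventually_ne_atTop 0] with t ht ht0
  have hmap : (P.map Complex.ofReal) ^ t = (P ^ t).map Complex.ofReal :=
    (Matrix.map_pow P Complex.ofRealHom t).symm
  rw [hmap, frobenius_norm_map_eq _ _ (fun a => Complex.norm_real a)] at ht
  have h2 : ‖P ^ t‖ ^ (1 / t : ℝ) ≤ r := by
    rw [← ENNReal.ofReal_coe_nnreal] at ht
    exact (ENNReal.ofReal_lt_ofReal_iff_of_nonneg (by positivity)).1 ht |>.le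
  calc ‖P ^ t‖ = (‖P ^ t‖ ^ (1 / t : ℝ)) ^ t := by
        rw [one_div, Real.rpow_inv_natCast_pow (norm_nonneg _) ht0]
    _ ≤ _ := by gcongr

theorem Matrix.PosDef.exists_mul_norm_sq_le_trace {m : ℕ} {R : Matrix (Fin m) (Fin m) ℝ}
    (hR : R.PosDef) :
    ∃ r > (0 : ℝ), ∀ {k : ℕ} (M : Matrix (Fin k) (Fin m) ℝ),
      r * ‖M‖ ^ 2 ≤ trace (M * R * Mᵀ) := by
  open scoped MatrixOrder in
  obtain ⟨B, rfl⟩ := CStarAlgebra.nonneg_iff_eq_star_mul_self.mp hR.posSemidef.nonneg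
  have hB : IsUnit B.det := by
    have := (isUnit_iff_isUnit_det _).1 hR.isUnit
    rw [det_mul] at this
    exact isUnit_of_mul_isUnit_right this
  refine ⟨(‖B⁻¹‖ ^ 2 + 1)⁻¹, by positivity, fun M => ?_⟩
  have h1 : trace (M * (star B * B) * Mᵀ) = ‖B * Mᵀ‖ ^ 2 := by
    rw [frobenius_norm_sq_eq_trace, star_eq_conjTranspose, conjTranspose_eq_transpose_of_trivial,
      transpose_mul, transpose_transpose]
    simp only [Matrix.mul_assoc]
  have h2 : ‖M‖ ≤ ‖B⁻¹‖ * ‖B * Mᵀ‖ := by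
    rw [← frobenius_norm_transpose M]
    calc ‖Mᵀ‖ = ‖B⁻¹ * (B * Mᵀ)‖ := by rw [nonsing_inv_mul_cancel_left _ _ hB]
      _ ≤ _ := frobenius_norm_mul _ _
  rw [h1, inv_mul_le_iff₀ (by positivity)]
  have h3 := pow_le_pow_left₀ (norm_nonneg M) h2 2
  nlinarith [sq_nonneg ‖B * Mᵀ‖]

end Frobenius

theorem summable_pow_mul_mul_transpose_pow {n : ℕ} {P : Matrix (Fin n) (Fin n) ℝ}
    (hP : specRad P < 1) (B : Matrix (Fin n) (Fin n) ℝ) :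
    Summable fun t : ℕ => P ^ t * B * Pᵀ ^ t := by
  open scoped Matrix.Norms.Frobenius in
  obtain ⟨r, hr0, hr1, hr⟩ := exists_norm_pow_le_of_specRad_lt_one hP
  refine Pi.summable.2 fun i => Pi.summable.2 fun j => ?_
  have hr2 : r ^ 2 < 1 := by nlinarith
  refine Summable.of_norm_bounded_eventually_nat
    ((summable_geometric_of_lt_one (sq_nonneg r) hr2).mul_left ‖B‖) ?_
  filter_upwards [hr] with t ht
  calc ‖(P ^ t * B * Pᵀ ^ t) i j‖ ≤ ‖P ^ t * B * Pᵀ ^ t‖ := norm_entry_le_frobenius_norm _ i j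
    _ ≤ ‖P ^ t‖ * ‖B‖ * ‖Pᵀ ^ t‖ :=
        (frobenius_norm_mul _ _).trans (by gcongr; exact frobenius_norm_mul _ _)
    _ ≤ r ^ t * ‖B‖ * r ^ t := by
        rw [← transpose_pow, frobenius_norm_transpose]
        gcongr
    _ = ‖B‖ * (r ^ 2) ^ t := by ring

theorem tsum_lyapunov {n : ℕ} {P : Matrix (Fin n) (Fin n) ℝ}
    (hP : specRad P < 1) (B : Matrix (Fin n) (Fin n) ℝ) :
    ∑' t : ℕ, P ^ t * B * Pᵀ ^ t = P * (∑' t : ℕ, P ^ t * B * Pᵀ ^ t) * Pᵀ + B := by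
  have h := summable_pow_mul_mul_transpose_pow hP B
  conv_lhs => rw [h.tsum_eq_zero_add]
  rw [← h.tsum_mul_left, ← (h.mul_left P).tsum_mul_right, add_comm]
  simp only [pow_zero, Matrix.one_mul, Matrix.mul_one]
  congr 1
  refine tsum_congr fun t => ?_
  rw [pow_succ', pow_succ]
  simp only [Matrix.mul_assoc]

theorem Matrix.PosSemidef.mul_mul_transpose_same {k l : ℕ} {M : Matrix (Fin k) (Fin k) ℝ}
    (hM : M.PosSemidef) (B : Matrix (Fin l) (Fin k) ℝ) : (B * M * Bᵀ).PosSemidef := by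
  simpa [conjTranspose_eq_transpose_of_trivial] using hM.mul_mul_conjTranspose_same B

theorem Matrix.PosSemidef.of_tendsto {n : ℕ} {f : ℕ → Matrix (Fin n) (Fin n) ℝ}
    {M : Matrix (Fin n) (Fin n) ℝ} (hf : Tendsto f atTop (𝓝 M))
    (hpos : ∀ᶠ N in atTop, (f N).PosSemidef) : M.PosSemidef := by
  refine .of_dotProduct_mulVec_nonneg ?_ fun x => ?_
  · refine tendsto_nhds_unique_of_eventuallyEq
      ((continuous_id.matrix_conjTranspose.tendsto M).comp hf) hf ?_
    filter_upwards [hpos] with N hN using hN.isHermitian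
  · have hc : Continuous fun B : Matrix (Fin n) (Fin n) ℝ => star x ⬝ᵥ (B *ᵥ x) := by fun_prop
    refine ge_of_tendsto ((hc.tendsto M).comp hf) ?_
    filter_upwards [hpos] with N hN using hN.dotProduct_mulVec_nonneg x

theorem lyapunov_sub_sum_eq {n : ℕ} {P E D : Matrix (Fin n) (Fin n) ℝ}
    (hE : E = P * E * Pᵀ + D) (N : ℕ) :
    ∑ t ∈ Finset.range N, P ^ t * D * Pᵀ ^ t = E - P ^ N * E * Pᵀ ^ N := by
  induction N with
  | zero => simp
  | succ N ih =>
    have h : P ^ N * E * Pᵀ ^ N = P ^ (N + 1) * E * Pᵀ ^ (N + 1) + P ^ N * D * Pᵀ ^ N := by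
      conv_lhs => rw [hE]
      rw [pow_succ, pow_succ']
      noncomm_ring
    rw [Finset.sum_range_succ, ih, h]
    abel

theorem posSemidef_lyapunov_sub_sum {n : ℕ} {P E D : Matrix (Fin n) (Fin n) ℝ}
    (hP : specRad P < 1) (hE : E = P * E * Pᵀ + D) (hD : D.PosSemidef) (N : ℕ) :
    (E - ∑ t ∈ Finset.range N, P ^ t * D * Pᵀ ^ t).PosSemidef := by
  have h0 := (summable_pow_mul_mul_transpose_pow hP E).tendsto_atTop_zero
  have h1 : Tendsto (fun M => ∑ t ∈ Finset.range M, P ^ t * D * Pᵀ ^ t) atTop (𝓝 E) := by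
    simp only [lyapunov_sub_sum_eq hE]
    simpa using h0.const_sub E
  refine .of_tendsto (h1.sub_const _) ?_
  filter_upwards [eventually_ge_atTop N] with M hM
  rw [← Finset.sum_Ico_eq_sub _ hM]
  refine posSemidef_sum _ fun t _ => ?_
  rw [← transpose_pow]
  exact hD.mul_mul_transpose_same _

section Frobenius

open scoped Matrix.Norms.Frobenius

theorem mul_sum_norm_sq_le_trace_lyapunov {n m : ℕ} {P E D : Matrix (Fin n) (Fin n) ℝ}
    (H : Matrix (Fin m) (Fin n) ℝ) {Δ : Matrix (Fin n) (Fin m) ℝ} {R : Matrix (Fin m) (Fin m) ℝ}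
    {r : ℝ} (hP : specRad P < 1) (hE : E = P * E * Pᵀ + D) (hR : R.PosSemidef)
    (hr : ∀ M : Matrix (Fin m) (Fin m) ℝ, r * ‖M‖ ^ 2 ≤ trace (M * R * Mᵀ))
    (hD : (D - Δ * R * Δᵀ).PosSemidef) (N : ℕ) :
    r * ∑ t ∈ Finset.range N, ‖H * P ^ t * Δ‖ ^ 2 ≤ trace (E * Hᵀ * H) := by
  have hD' : D.PosSemidef := by simpa using hD.add (hR.mul_mul_transpose_same Δ)
  have h1 := ((posSemidef_lyapunov_sub_sum hP hE hD' N).mul_mul_transpose_same H).trace_nonneg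
  rw [Matrix.mul_sub, Matrix.sub_mul, trace_sub, sub_nonneg] at h1
  rw [trace_mul_cycle]
  refine le_trans ?_ h1
  rw [Matrix.mul_sum, Matrix.sum_mul, trace_sum, Finset.mul_sum]
  refine Finset.sum_le_sum fun t _ => (hr _).trans ?_
  have h2 := (hD.mul_mul_transpose_same (H * P ^ t)).trace_nonneg
  rw [Matrix.mul_sub, Matrix.sub_mul, trace_sub, sub_nonneg] at h2
  simpa only [transpose_mul, transpose_pow, Matrix.mul_assoc] using h2

theorem pow_eq_closedLoop_pow_add_sum {n m : ℕ} (A : Matrix (Fin n) (Fin n) ℝ)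
    (H : Matrix (Fin m) (Fin n) ℝ) (L : Matrix (Fin n) (Fin m) ℝ) (t : ℕ) :
    A ^ t = (A - L * H) ^ t +
      ∑ s ∈ Finset.range t, (A - L * H) ^ s * L * H * A ^ (t - 1 - s) := by
  induction t with
  | zero => simp
  | succ t ih =>
    have h1 : A ^ (t + 1) = (A - L * H) * A ^ t + L * H * A ^ t := by
      rw [pow_succ']
      noncomm_ring
    rw [h1, Finset.sum_range_succ']
    conv_lhs => enter [1]; rw [ih]
    rw [Matrix.mul_add, Matrix.mul_sum, ← pow_succ', add_assoc]
    congr 2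
    · refine Finset.sum_congr rfl fun s _ => ?_
      rw [show t + 1 - 1 - (s + 1) = t - 1 - s by omega, pow_succ']
      simp only [Matrix.mul_assoc]
    · simp

theorem norm_openLoop_output_le {n m : ℕ} (A : Matrix (Fin n) (Fin n) ℝ)
    (H : Matrix (Fin m) (Fin n) ℝ) (L Δ : Matrix (Fin n) (Fin m) ℝ) {K e : ℝ} (hK : 0 ≤ K) {N : ℕ}
    (hL : ∀ s < N, ‖H * (A - L * H) ^ s * L‖ ≤ K)
    (hΔ : ∀ s < N, ‖H * (A - L * H) ^ s * Δ‖ ≤ e) (t : ℕ) (ht : t < N) :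
    ‖H * A ^ t * Δ‖ ≤ (1 + K) ^ t * e := by
  induction t using Nat.strong_induction_on with
  | _ t ih =>
    have h1 : H * A ^ t * Δ = H * (A - L * H) ^ t * Δ +
        ∑ s ∈ Finset.range t, H * (A - L * H) ^ s * L * (H * A ^ (t - 1 - s) * Δ) := by
      conv_lhs => rw [pow_eq_closedLoop_pow_add_sum A H L t]
      rw [Matrix.mul_add, Matrix.add_mul, Matrix.mul_sum, Matrix.sum_mul]
      simp only [Matrix.mul_assoc]
    have h2 : ∀ s ∈ Finset.range t,
        ‖H * (A - L * H) ^ s * L * (H * A ^ (t - 1 - s) * Δ)‖ ≤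
          K * ((1 + K) ^ (t - 1 - s) * e) := by
      intro s hs
      have hs' := Finset.mem_range.1 hs
      refine (frobenius_norm_mul _ _).trans ?_
      exact mul_le_mul (hL s (by omega)) (ih _ (by omega) (by omega)) (norm_nonneg _) hK
    calc ‖H * A ^ t * Δ‖ ≤ e + ∑ s ∈ Finset.range t, K * ((1 + K) ^ (t - 1 - s) * e) := by
          rw [h1]
          exact (norm_add_le _ _).trans <|
            add_le_add (hΔ t ht) ((norm_sum_le _ _).trans (Finset.sum_le_sum h2))
      _ = (1 + K) ^ t * e := by
          rw [Finset.sum_range_reflect (fun s => K * ((1 + K) ^ s * e)) t, ← Finset.mul_sum,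
            ← Finset.sum_mul]
          have := mul_geom_sum (1 + K) t
          linear_combination e * this

theorem exists_norm_le_of_observable {n m : ℕ} {A : Matrix (Fin n) (Fin n) ℝ}
    {H : Matrix (Fin m) (Fin n) ℝ}
    (hObs : ∀ v : Fin n → ℝ,
      (∀ t : ℕ, t ≤ n - 1 → H.mulVec ((A ^ t).mulVec v) = 0) → v = 0) (hn : 0 < n) :
    ∃ C > (0 : ℝ), ∀ (Δ : Matrix (Fin n) (Fin m) ℝ) (b : ℝ), 0 ≤ b →
      (∀ t < n, ‖H * A ^ t * Δ‖ ≤ b) → ‖Δ‖ ≤ C * b := by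
  let f : Matrix (Fin n) (Fin m) ℝ →ₗ[ℝ] (Fin n → Matrix (Fin m) (Fin m) ℝ) :=
    LinearMap.pi fun t =>
      { toFun := fun Δ => H * A ^ (t : ℕ) * Δ
        map_add' := fun x y => Matrix.mul_add _ x y
        map_smul' := fun a x => Matrix.mul_smul _ a x }
  have hf : LinearMap.ker f = ⊥ := by
    refine LinearMap.ker_eq_bot'.2 fun Δ hΔ => ?_
    ext i j
    refine congrFun (hObs (fun i => Δ i j) fun t ht => ?_) i
    have h1 : H * A ^ t * Δ = 0 := congrFun hΔ ⟨t, by omega⟩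
    ext k
    have h2 : (H * (A ^ t * Δ)) k j = 0 := by rw [← Matrix.mul_assoc, h1]; rfl
    exact h2
  obtain ⟨C, hC, hfC⟩ := f.exists_antilipschitzWith hf
  refine ⟨C, hC, fun Δ b hb h => ?_⟩
  have h1 := hfC.le_mul_dist Δ 0
  rw [map_zero, dist_zero_right, dist_zero_right] at h1
  refine h1.trans ?_
  gcongr
  exact (pi_norm_le_iff_of_nonneg hb).2 fun t => h t t.2

theorem exists_mul_norm_sq_le_sum_closedLoop {n m : ℕ} {A : Matrix (Fin n) (Fin n) ℝ}
    {H : Matrix (Fin m) (Fin n) ℝ}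
    (hObs : ∀ v : Fin n → ℝ,
      (∀ t : ℕ, t ≤ n - 1 → H.mulVec ((A ^ t).mulVec v) = 0) → v = 0) (hn : 0 < n)
    {K : ℝ} (hK : 0 ≤ K) :
    ∃ c > (0 : ℝ), ∀ L : Matrix (Fin n) (Fin m) ℝ,
      (∀ s < n, ‖H * (A - L * H) ^ s * L‖ ≤ K) → ∀ Δ : Matrix (Fin n) (Fin m) ℝ,
        c * ‖Δ‖ ^ 2 ≤ ∑ t ∈ Finset.range n, ‖H * (A - L * H) ^ t * Δ‖ ^ 2 := by
  obtain ⟨C, hC, hCb⟩ := exists_norm_le_of_observable hObs hn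
  refine ⟨((C * (1 + K) ^ n) ^ 2)⁻¹, by positivity, fun L hL Δ => ?_⟩
  set s := ∑ t ∈ Finset.range n, ‖H * (A - L * H) ^ t * Δ‖ ^ 2 with hs
  have hs0 : 0 ≤ s := Finset.sum_nonneg fun _ _ => sq_nonneg _
  have h1 : ∀ t < n, ‖H * (A - L * H) ^ t * Δ‖ ≤ √s := fun t ht =>
    Real.le_sqrt_of_sq_le (Finset.single_le_sum
      (f := fun t => ‖H * (A - L * H) ^ t * Δ‖ ^ 2) (fun _ _ => sq_nonneg _)
      (Finset.mem_range.2 ht))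
  have h2 : ‖Δ‖ ≤ C * ((1 + K) ^ n * √s) := by
    refine hCb Δ _ (by positivity) fun t ht =>
      (norm_openLoop_output_le A H L Δ hK hL h1 t ht).trans ?_
    gcongr
    linarith
  rw [inv_mul_le_iff₀ (by positivity)]
  calc ‖Δ‖ ^ 2 ≤ (C * ((1 + K) ^ n * √s)) ^ 2 := by gcongr
    _ = (C * (1 + K) ^ n) ^ 2 * √s ^ 2 := by ring
    _ = _ := by rw [Real.sq_sqrt hs0]

theorem specRad_lt_one_of_lyapunov {n : ℕ} (hn : 0 < n) {P X Q : Matrix (Fin n) (Fin n) ℝ}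
    (hX : X.PosSemidef) (hQ : Q.PosDef) (h : (X - P * X * Pᵀ - Q).PosSemidef) :
    specRad P < 1 := by
  have : CompleteSpace (Matrix (Fin n) (Fin n) ℂ) := FiniteDimensional.complete ℂ _
  have : Nonempty (Fin n) := ⟨⟨0, hn⟩⟩
  refine spectrum.spectralRadius_lt_of_forall_lt (A := Matrix (Fin n) (Fin n) ℂ) _ (r := 1)
    fun z hz => ?_
  rw [spectrum.mem_iff, isUnit_iff_isUnit_det, isUnit_iff_ne_zero, not_not] at hz
  obtain ⟨v, hv, hvz⟩ := exists_vecMul_eq_zero_iff.2 hz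
  set a : Fin n → ℝ := fun i => (v i).re with ha
  set b : Fin n → ℝ := fun i => (v i).im with hb
  have hvP : ∀ j, ∑ i, v i * (P i j : ℂ) = z * v j := by
    intro j
    have h1 := congrFun hvz j
    rw [vecMul_sub, Algebra.algebraMap_eq_smul_one, vecMul_smul, vecMul_one] at h1
    exact (sub_eq_zero.1 (by simpa [vecMul, dotProduct] using h1)).symm
  have haP : a ᵥ* P = z.re • a - z.im • b := by
    ext j
    simpa [vecMul, dotProduct] using congrArg Complex.re (hvP j)
  have hbP : b ᵥ* P = z.re • b + z.im • a := by
    ext j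
    simpa [vecMul, dotProduct] using congrArg Complex.im (hvP j)
  have key : ∀ w : Fin n → ℝ, (w ᵥ* P) ⬝ᵥ (X *ᵥ (w ᵥ* P)) + w ⬝ᵥ (Q *ᵥ w) ≤ w ⬝ᵥ (X *ᵥ w) := by
    intro w
    have h1 := h.dotProduct_mulVec_nonneg w
    simp only [star_trivial, sub_mulVec, dotProduct_sub, ← mulVec_mulVec, mulVec_transpose] at h1
    rw [dotProduct_mulVec w P] at h1
    linarith
  have hka := key a
  have hkb := key b
  have hsum : (a ᵥ* P) ⬝ᵥ (X *ᵥ (a ᵥ* P)) + (b ᵥ* P) ⬝ᵥ (X *ᵥ (b ᵥ* P)) =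
      (z.re ^ 2 + z.im ^ 2) * (a ⬝ᵥ (X *ᵥ a) + b ⬝ᵥ (X *ᵥ b)) := by
    rw [haP, hbP]
    simp only [mulVec_sub, mulVec_add, mulVec_smul, dotProduct_sub, sub_dotProduct, dotProduct_add,
      add_dotProduct, smul_dotProduct, dotProduct_smul, smul_eq_mul]
    ring
  have hQpos : 0 < a ⬝ᵥ (Q *ᵥ a) + b ⬝ᵥ (Q *ᵥ b) := by
    have hQa := hQ.posSemidef.dotProduct_mulVec_nonneg a
    have hQb := hQ.posSemidef.dotProduct_mulVec_nonneg b
    rw [star_trivial] at hQa hQb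
    by_cases ha0 : a = 0
    · have hb0 : b ≠ 0 := by
        rintro hb0
        exact hv (funext fun i => Complex.ext (congrFun ha0 i) (congrFun hb0 i))
      have := hQ.dotProduct_mulVec_pos hb0
      rw [star_trivial] at this
      linarith
    · have := hQ.dotProduct_mulVec_pos ha0
      rw [star_trivial] at this
      linarith
  have hXa := hX.dotProduct_mulVec_nonneg a
  have hXb := hX.dotProduct_mulVec_nonneg b
  rw [star_trivial] at hXa hXb
  have hz2 : ‖z‖ ^ 2 < 1 := by
    rw [← Complex.normSq_eq_norm_sq, Complex.normSq_apply]
    by_contra! hcon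
    nlinarith
  rw [← NNReal.coe_lt_coe, coe_nnnorm, NNReal.coe_one]
  nlinarith [norm_nonneg z]

theorem lyapunov_complete_square {n m : ℕ} {A X : Matrix (Fin n) (Fin n) ℝ}
    {H : Matrix (Fin m) (Fin n) ℝ} {R : Matrix (Fin m) (Fin m) ℝ} {G : Matrix (Fin n) (Fin m) ℝ}
    (hX : Xᵀ = X) (hR : Rᵀ = R) (hG : G * (R + H * X * Hᵀ) = A * X * Hᵀ)
    (L : Matrix (Fin n) (Fin m) ℝ) :
    (A - L * H) * X * (A - L * H)ᵀ + L * R * Lᵀ =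
      (A - G * H) * X * (A - G * H)ᵀ + G * R * Gᵀ +
        (L - G) * (R + H * X * Hᵀ) * (L - G)ᵀ := by
  have h1 : (R + H * X * Hᵀ) * Gᵀ = H * X * Aᵀ := by
    have := congrArg transpose hG
    simpa [transpose_mul, hX, hR, Matrix.mul_assoc] using this
  have expand : ∀ L : Matrix (Fin n) (Fin m) ℝ, (A - L * H) * X * (A - L * H)ᵀ + L * R * Lᵀ =
      A * X * Aᵀ - L * (H * X * Aᵀ) - (A * X * Hᵀ) * Lᵀ + L * (R + H * X * Hᵀ) * Lᵀ := by
    intro L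
    simp only [transpose_sub, transpose_mul, Matrix.sub_mul, Matrix.mul_sub, Matrix.add_mul,
      Matrix.mul_add, Matrix.mul_assoc]
    abel
  rw [expand, expand, ← hG, ← h1]
  generalize R + H * X * Hᵀ = W
  simp only [transpose_sub, Matrix.sub_mul, Matrix.mul_sub, Matrix.mul_assoc]
  abel

end Frobenius

theorem stmt_8 {n m : ℕ} (hn : 0 < n) (hm : 0 < m)
    (A : Matrix (Fin n) (Fin n) ℝ) (H : Matrix (Fin m) (Fin n) ℝ)
    (Q : Matrix (Fin n) (Fin n) ℝ) (R : Matrix (Fin m) (Fin m) ℝ)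
    (hQ : Q.PosDef) (hR : R.PosDef)
    (hObs : ∀ v : Fin n → ℝ,
      (∀ t : ℕ, t ≤ n - 1 → H.mulVec ((A ^ t).mulVec v) = 0) → v = 0)
    (S : Set (Matrix (Fin n) (Fin m) ℝ))
    (hS : S = {L | specRad (A - L * H) < 1})
    (hSne : S.Nonempty)
    (X : Matrix (Fin n) (Fin m) ℝ → Matrix (Fin n) (Fin n) ℝ)
    (hX : ∀ L, X L = ∑' t : ℕ, (A - L * H) ^ t * (Q + L * R * Lᵀ) * ((A - L * H)ᵀ) ^ t)
    (J : Matrix (Fin n) (Fin m) ℝ → ℝ)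
    (hJ : ∀ L, J L = Matrix.trace (X L * Hᵀ * H) + Matrix.trace R)
    (Lstar : Matrix (Fin n) (Fin m) ℝ) (hLstarS : Lstar ∈ S)
    (hLstarMin : ∀ L ∈ S, J Lstar ≤ J L)
    (α : ℝ) (hα : 0 < α) (hαne : {L | L ∈ S ∧ J L ≤ α}.Nonempty) :
    ∃ c₃ > (0 : ℝ), ∀ L, L ∈ S → J L ≤ α →
      c₃ * frobNorm (L - Lstar) ^ 2 ≤ J L - J Lstar := by
  subst hS
  have hLyap : ∀ L, specRad (A - L * H) < 1 →
      X L = (A - L * H) * X L * (A - L * H)ᵀ + (Q + L * R * Lᵀ) := by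
    intro L hL
    rw [hX]
    exact tsum_lyapunov hL _
  have hRs : Rᵀ = R := by
    simpa [conjTranspose_eq_transpose_of_trivial] using hR.isHermitian.eq
  have hD : ∀ L : Matrix (Fin n) (Fin m) ℝ, (Q + L * R * Lᵀ).PosSemidef := fun L =>
    hQ.posSemidef.add (hR.posSemidef.mul_mul_transpose_same L)
  have hXpos : (X Lstar).PosSemidef := by
    simpa using posSemidef_lyapunov_sub_sum hLstarS (hLyap _ hLstarS) (hD _) 0
  have hXs : (X Lstar)ᵀ = X Lstar := by
    simpa [conjTranspose_eq_transpose_of_trivial] using hXpos.isHermitian.eq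
  set W := R + H * X Lstar * Hᵀ with hW
  have hHX := hXpos.mul_mul_transpose_same H
  have hWpos : W.PosDef := hR.add_posSemidef hHX
  open scoped Matrix.Norms.Frobenius in
  obtain ⟨r, hr, hrR⟩ := hR.exists_mul_norm_sq_le_trace
  have hcoer : ∀ β : ℝ, ∃ c > (0 : ℝ), ∀ L, specRad (A - L * H) < 1 → J L ≤ β →
      ∀ Δ : Matrix (Fin n) (Fin m) ℝ,
        c * ‖Δ‖ ^ 2 ≤ ∑ t ∈ Finset.range n, ‖H * (A - L * H) ^ t * Δ‖ ^ 2 := by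
    intro β
    obtain ⟨c, hc, hcL⟩ :=
      exists_mul_norm_sq_le_sum_closedLoop hObs hn (K := √(|β| / r)) (Real.sqrt_nonneg _)
    refine ⟨c, hc, fun L hL hJL => hcL L fun s hs => Real.le_sqrt_of_sq_le ?_⟩
    have h1 := mul_sum_norm_sq_le_trace_lyapunov H (Δ := L) hL (hLyap L hL) hR.posSemidef hrR
      (by simpa using hQ.posSemidef) n
    have h2 : ‖H * (A - L * H) ^ s * L‖ ^ 2 ≤
        ∑ t ∈ Finset.range n, ‖H * (A - L * H) ^ t * L‖ ^ 2 :=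
      Finset.single_le_sum (f := fun t => ‖H * (A - L * H) ^ t * L‖ ^ 2)
        (fun _ _ => sq_nonneg _) (Finset.mem_range.2 hs)
    rw [le_div_iff₀ hr]
    have h3 := hR.posSemidef.trace_nonneg
    rw [hJ] at hJL
    nlinarith [le_abs_self β]
  -- the gain improving on `Lstar`
  obtain ⟨G, hG⟩ : ∃ G, G * W = A * X Lstar * Hᵀ :=
    ⟨A * X Lstar * Hᵀ * W⁻¹,
      nonsing_inv_mul_cancel_right _ _ ((isUnit_iff_isUnit_det _).1 hWpos.isUnit)⟩
  have hsq := lyapunov_complete_square hXs hRs hG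
  have hstar := hLyap _ hLstarS
  have hΔ : ∀ Δ : Matrix (Fin n) (Fin m) ℝ, (Δ * W * Δᵀ - Δ * R * Δᵀ).PosSemidef := fun Δ => by
    rw [← Matrix.sub_mul, ← Matrix.mul_sub, hW, add_sub_cancel_left]
    exact hHX.mul_mul_transpose_same Δ
  have hGS : specRad (A - G * H) < 1 := by
    refine specRad_lt_one_of_lyapunov hn hXpos hQ ?_
    have h1 : X Lstar - (A - G * H) * X Lstar * (A - G * H)ᵀ - Q =
        G * R * Gᵀ + (Lstar - G) * W * (Lstar - G)ᵀ := by
      have h2 := hsq Lstar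
      conv_lhs => enter [1, 1]; rw [hstar]
      rw [← add_assoc, add_right_comm, h2]
      abel
    rw [h1]
    exact (hR.posSemidef.mul_mul_transpose_same G).add
      (hWpos.posSemidef.mul_mul_transpose_same _)
  have hGstar : Lstar = G := by
    obtain ⟨c, hc, hcL⟩ := hcoer (J G)
    have hE : X Lstar - X G = (A - G * H) * (X Lstar - X G) * (A - G * H)ᵀ +
        (Lstar - G) * W * (Lstar - G)ᵀ := by
      have h2 := hsq Lstar
      rw [Matrix.mul_sub, Matrix.sub_mul]
      linear_combination (norm := abel) hstar - hLyap G hGS + h2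
    have h1 := mul_sum_norm_sq_le_trace_lyapunov H hGS hE hR.posSemidef hrR (hΔ _) n
    have h2 := hcL G hGS le_rfl (Lstar - G)
    have h3 := hLstarMin G hGS
    rw [hJ, hJ] at h3
    rw [Matrix.sub_mul, Matrix.sub_mul, trace_sub] at h1
    have h4 : ‖Lstar - G‖ ^ 2 ≤ 0 := by
      by_contra! hpos
      have := mul_pos hr (mul_pos hc hpos)
      have := mul_le_mul_of_nonneg_left h2 hr.le
      linarith
    rw [← sub_eq_zero, ← norm_eq_zero]
    exact pow_eq_zero_iff two_ne_zero |>.1 (le_antisymm h4 (sq_nonneg _))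
  obtain ⟨c, hc, hcL⟩ := hcoer α
  refine ⟨r * c, mul_pos hr hc, fun L hL hJL => ?_⟩
  have hE : X L - X Lstar = (A - L * H) * (X L - X Lstar) * (A - L * H)ᵀ +
      (L - Lstar) * W * (L - Lstar)ᵀ := by
    rw [← hGstar] at hsq
    have h2 := hsq L
    rw [Matrix.mul_sub, Matrix.sub_mul]
    linear_combination (norm := abel) hLyap L hL - hstar + h2
  have h1 := mul_sum_norm_sq_le_trace_lyapunov H hL hE hR.posSemidef hrR (hΔ _) n
  have h2 := mul_le_mul_of_nonneg_left (hcL L hL hJL (L - Lstar)) hr.le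
  rw [Matrix.sub_mul, Matrix.sub_mul, trace_sub] at h1
  rw [frobNorm_eq_norm, hJ, hJ]
  linarith
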